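/- arXiv:1904.08296 — 2 statements merged into one kernel-verified Lean document; each statement's English description precedes it below -/
import Mathlib

section
/- Let n be a positive integer and write n = b²·c with c squarefree (equivalently, b is the largest positive integer with b² ∣ n). Then the number of integers k with 1 ≤ k ≤ n and n ∣ k² equals b. -/
theorem Squarefree.sq_mul_dvd_sq_iff {b c k : ℕ} (hb : b ≠ 0) (hc : Squarefree c) :
    b ^ 2 * c ∣ k ^ 2 ↔ b * c ∣ k := by
  have hb2 : 0 < b ^ 2 := by positivity
  constructor
  · intro hk
    obtain ⟨m, rfl⟩ := (Nat.pow_dvd_pow_iff two_ne_zero).mp (dvd_of_mul_right_dvd hk)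
    rw [mul_pow, Nat.mul_dvd_mul_iff_left hb2] at hk
    exact mul_dvd_mul_left b ((hc.dvd_pow_iff_dvd two_ne_zero).mp hk)
  · rintro ⟨m, rfl⟩
    exact ⟨c * m ^ 2, by ring⟩

/-- If `n = b²·c` with `c` squarefree, then the number of `1 ≤ k ≤ n` with `n ∣ k²` is `b`. -/
theorem statement11 (n b c : ℕ) (hn : 0 < n) (h : n = b ^ 2 * c) (hc : Squarefree c) :
    ((Finset.Icc 1 n).filter fun k => n ∣ k ^ 2).card = b := by
  subst h
  have hb : b ≠ 0 := by
    rintro rfl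
    simp at hn
  have hbc : 0 < b * c := Nat.mul_pos hb.bot_lt hc.ne_zero.bot_lt
  simp_rw [hc.sq_mul_dvd_sq_iff hb]
  exact (Nat.Ioc_filter_dvd_card_eq_div (b ^ 2 * c) (b * c)).trans
    (Nat.div_eq_of_eq_mul_left hbc (by ring))
end

section
/- Let D be a positive squarefree integer with D ≡ 1 or 2 (mod 4), let f be a positive integer, and let a be an integer with gcd(a, f) = 1. Then the number of triples (α, β, γ) ∈ (ℤ/fℤ)³ satisfying (αβ + 1)² + D·(βγ)² ≡ a (mod f) is at most 2·4^{ω(f)}·τ(f)·f². -/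
section Counting

variable {R : Type*} [CommRing R] [Fintype R] [DecidableEq R]

open Finset

/-- A fibre of an affine map `x ↦ b * x + e` is no larger than the annihilator of `b`. -/
theorem card_affine_fiber_le (b e r : R) (s : Finset R) (hs : ∀ x ∈ s, b * x + e = r) :
    #s ≤ #{x : R | b * x = 0} := by
  obtain rfl | ⟨x₀, hx₀⟩ := s.eq_empty_or_nonempty
  · simp
  · refine card_le_card_of_injOn (fun x ↦ x - x₀) (fun x hx ↦ ?_) (sub_left_injective.injOn)
    simp only [coe_filter, mem_univ, true_and, Set.mem_ofPred_eq]
    linear_combination hs x hx - hs x₀ hx₀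

/-- A unit has at most as many square roots as `1`. -/
theorem card_isUnit_sq_eq_le (c : R) (s : Finset R) (hs : ∀ x ∈ s, IsUnit x ∧ x ^ 2 = c) :
    #s ≤ #{u : R | u ^ 2 = 1} := by
  obtain rfl | ⟨x₀, hx₀⟩ := s.eq_empty_or_nonempty
  · simp
  · obtain ⟨⟨u, rfl⟩, hu⟩ := hs x₀ hx₀
    refine card_le_card_of_injOn (fun x ↦ x * ↑u⁻¹) (fun x hx ↦ ?_)
      (u⁻¹.isUnit.mul_left_injective.injOn)
    simp only [coe_filter, mem_univ, true_and, Set.mem_ofPred_eq]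
    rw [mul_pow, (hs x hx).2, ← hu, ← mul_pow, Units.mul_inv, one_pow]

theorem card_affine_isUnit_sq_eq_le (b e c : R) :
    #{x : R | IsUnit (b * x + e) ∧ (b * x + e) ^ 2 = c} ≤
      #{x : R | b * x = 0} * #{u : R | u ^ 2 = 1} := by
  classical
  refine (card_le_mul_card_image (f := fun x ↦ b * x + e) _ #{x : R | b * x = 0} ?_).trans ?_
  · intro r _
    exact card_affine_fiber_le b e r _ fun x hx ↦ (mem_filter.1 hx).2
  · refine Nat.mul_le_mul_left _ (card_isUnit_sq_eq_le c _ fun x hx ↦ ?_)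
    obtain ⟨y, hy, rfl⟩ := mem_image.1 hx
    exact (mem_filter.1 hy).2

theorem card_solutions_le [IsLocalRing R] (D a : R) (ha : IsUnit a) :
    #{t : R × R × R | (t.1 * t.2.1 + 1) ^ 2 + D * (t.2.1 * t.2.2) ^ 2 = a} ≤
      2 * #{u : R | u ^ 2 = 1} * Fintype.card R * #{t : R × R | t.1 * t.2 = 0} := by
  classical
  set s := #{u : R | u ^ 2 = 1} with hs
  have first : #{t : R × R × R | IsUnit (t.2.1 * t.1 + 1) ∧
      (t.2.1 * t.1 + 1) ^ 2 = a - D * (t.2.1 * t.2.2) ^ 2} ≤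
      s * Fintype.card R * #{t : R × R | t.1 * t.2 = 0} := by
    simp only [card_filter, Fintype.sum_prod_type]
    rw [sum_comm, mul_sum]
    refine sum_le_sum fun b _ ↦ ?_
    rw [sum_comm]
    refine (sum_le_card_nsmul _ _ (#{x : R | b * x = 0} * s) fun c _ ↦ ?_).trans_eq ?_
    · simpa only [card_filter, hs] using
        card_affine_isUnit_sq_eq_le b 1 (a - D * (b * c) ^ 2)
    · rw [card_univ, smul_eq_mul, card_filter]
      ring
  have second : #{t : R × R × R | IsUnit (t.2.1 * t.2.2 + 0) ∧
      (t.2.1 * t.2.2 + 0) ^ 2 = Ring.inverse D * (a - (t.1 * t.2.1 + 1) ^ 2)} ≤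
      s * Fintype.card R * #{t : R × R | t.1 * t.2 = 0} := by
    simp only [card_filter, Fintype.sum_prod_type]
    rw [sum_comm, mul_sum]
    refine sum_le_sum fun b _ ↦ ?_
    refine (sum_le_card_nsmul _ _ (#{x : R | b * x = 0} * s) fun c _ ↦ ?_).trans_eq ?_
    · simpa only [card_filter, hs] using
        card_affine_isUnit_sq_eq_le b 0 (Ring.inverse D * (a - (c * b + 1) ^ 2))
    · rw [card_univ, smul_eq_mul, card_filter]
      ring
  refine (card_le_card (fun t ht ↦ ?_)).trans
    ((card_union_le _ _).trans ((add_le_add first second).trans_eq (by ring)))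
  obtain ⟨x, b, c⟩ := t
  simp only [mem_filter, mem_univ, true_and, mem_union] at ht ⊢
  obtain h | h := IsLocalRing.isUnit_or_isUnit_of_isUnit_add (ht ▸ ha)
  · left
    rw [isUnit_pow_iff two_ne_zero, mul_comm x b] at h
    exact ⟨h, by linear_combination ht⟩
  · right
    obtain ⟨hD, h⟩ := isUnit_of_mul_isUnit_left h, isUnit_of_mul_isUnit_right h
    rw [isUnit_pow_iff two_ne_zero] at h
    rw [add_zero]
    refine ⟨h, ?_⟩
    linear_combination Ring.inverse D * ht - (b * c) ^ 2 * Ring.inverse_mul_cancel D hD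

end Counting

namespace ZMod

open Finset

theorem card_dvd_val_le {n d : ℕ} [NeZero n] (hd : d ∣ n) :
    #{x : ZMod n | d ∣ x.val} ≤ n / d := by
  calc #{x : ZMod n | d ∣ x.val} ≤ #((range (n / d)).image fun i ↦ ((d * i : ℕ) : ZMod n)) := by
        refine card_le_card fun x hx ↦ ?_
        obtain ⟨i, hi⟩ := (mem_filter.1 hx).2
        refine mem_image.2 ⟨i, mem_range.2 ?_, by rw [← hi, natCast_zmod_val]⟩
        rw [Nat.lt_div_iff_mul_lt' hd, ← hi]
        exact x.val_lt
    _ ≤ n / d := card_image_le.trans_eq (card_range _)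

theorem card_mul_eq_zero_le (n : ℕ) [NeZero n] :
    #{t : ZMod n × ZMod n | t.1 * t.2 = 0} ≤ n.divisors.card * n := by
  classical
  calc #{t : ZMod n × ZMod n | t.1 * t.2 = 0}
      ≤ #(n.divisors.biUnion fun d ↦
          ({x : ZMod n | d ∣ x.val} : Finset (ZMod n)) ×ˢ
            ({x : ZMod n | n / d ∣ x.val} : Finset (ZMod n))) := by
        refine card_le_card fun t ht ↦ ?_
        have ht : n ∣ t.1.val * t.2.val := by
          rw [← natCast_eq_zero_iff]
          simpa using ht
        have hpos : 0 < n.gcd t.1.val := Nat.gcd_pos_of_pos_left _ (NeZero.pos n)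
        simp only [mem_biUnion, Nat.mem_divisors, mem_product, mem_filter, mem_univ, true_and]
        refine ⟨n.gcd t.1.val, ⟨Nat.gcd_dvd_left _ _, NeZero.ne n⟩, Nat.gcd_dvd_right _ _, ?_⟩
        refine (Nat.coprime_div_gcd_div_gcd hpos).dvd_of_dvd_mul_left ?_
        rw [← Nat.mul_dvd_mul_iff_right hpos, Nat.div_mul_cancel (Nat.gcd_dvd_left _ _),
          mul_right_comm, Nat.div_mul_cancel (Nat.gcd_dvd_right _ _)]
        exact ht
    _ ≤ n.divisors.card * n := by
        refine card_biUnion_le_card_mul _ _ _ fun d hd ↦ ?_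
        have hd := Nat.dvd_of_mem_divisors hd
        rw [card_product]
        refine (Nat.mul_le_mul (card_dvd_val_le hd)
          (card_dvd_val_le (Nat.div_dvd_of_dvd hd))).trans_eq ?_
        rw [Nat.div_div_self hd (NeZero.ne n), Nat.div_mul_cancel hd]

theorem isLocalRing_prime_pow {p k : ℕ} (hp : p.Prime) (hk : 0 < k) :
    IsLocalRing (ZMod (p ^ k)) := by
  have : Fact (1 < p ^ k) := ⟨Nat.one_lt_pow hk.ne' hp.one_lt⟩
  have : NeZero (p ^ k) := ⟨(pow_pos hp.pos k).ne'⟩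
  have isUnit_iff (z : ℤ) : IsUnit (z : ZMod (p ^ k)) ↔ ¬ (p : ℤ) ∣ z := by
    rw [coe_int_isUnit_iff_isCoprime, Nat.cast_pow, IsCoprime.pow_left_iff hk,
      (Nat.prime_iff_prime_int.1 hp).coprime_iff_not_dvd]
  refine IsLocalRing.of_nonunits_add fun x y hx hy ↦ ?_
  obtain ⟨x, rfl⟩ := intCast_surjective x
  obtain ⟨y, rfl⟩ := intCast_surjective y
  rw [mem_nonunits_iff, ← Int.cast_add]
  rw [mem_nonunits_iff, isUnit_iff, not_not] at *
  exact dvd_add hx hy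

theorem card_sq_eq_one_le_two {p k : ℕ} [NeZero (p ^ k)] (hp : p.Prime) (hp2 : p ≠ 2)
    (hk : 0 < k) : #{u : ZMod (p ^ k) | u ^ 2 = 1} ≤ 2 := by
  have := isLocalRing_prime_pow hp hk
  have h2 : IsUnit ((2 : ℕ) : ZMod (p ^ k)) := by
    rw [isUnit_iff_coprime]
    exact (((Nat.coprime_primes hp Nat.prime_two).2 hp2).pow_left k).symm
  refine (card_le_card (t := {1, -1}) fun u hu ↦ ?_).trans card_le_two
  have hu : (u + 1) * (1 - u) = 0 := by
    linear_combination -(mem_filter.1 hu).2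
  have hsum : IsUnit ((u + 1) + (1 - u)) := by
    convert h2 using 1
    push_cast
    ring
  rw [mem_insert, mem_singleton]
  obtain h | h := IsLocalRing.isUnit_or_isUnit_of_isUnit_add hsum
  · exact .inl (sub_eq_zero.1 (h.mul_right_eq_zero.1 hu)).symm
  · exact .inr (eq_neg_of_add_eq_zero_left (h.mul_left_eq_zero.1 hu))

theorem card_sq_eq_one_two_pow_le_four (k : ℕ) [NeZero (2 ^ (k + 1))] :
    #{u : ZMod (2 ^ (k + 1)) | u ^ 2 = 1} ≤ 4 := by
  have cast_eq (z : ℤ) (hz : (2 : ℤ) ^ k ∣ z) :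
      (z : ZMod (2 ^ (k + 1))) = 0 ∨ (z : ZMod (2 ^ (k + 1))) = 2 ^ k := by
    have hzero : (2 : ZMod (2 ^ (k + 1))) ^ (k + 1) = 0 := by
      exact_mod_cast natCast_self (2 ^ (k + 1))
    obtain ⟨w, rfl⟩ := hz
    obtain ⟨v, rfl | rfl⟩ := w.even_or_odd'
    · left
      push_cast
      linear_combination (v : ZMod (2 ^ (k + 1))) * hzero
    · right
      push_cast
      linear_combination (v : ZMod (2 ^ (k + 1))) * hzero
  refine (card_le_card (t := {1, 1 + 2 ^ k, -1, -1 + 2 ^ k}) fun u hu ↦ ?_).trans card_le_four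
  obtain ⟨z, rfl⟩ := intCast_surjective u
  have hz : (2 : ℤ) ^ (k + 1) ∣ (z - 1) * (z + 1) := by
    have h := (intCast_zmod_eq_zero_iff_dvd ((z - 1) * (z + 1)) (2 ^ (k + 1))).1 (by
      push_cast
      linear_combination (mem_filter.1 hu).2)
    exact_mod_cast h
  have hodd : Odd z := by
    by_contra h
    rw [Int.not_odd_iff_even] at h
    have h1 : Odd ((z - 1) * (z + 1)) := (h.sub_odd odd_one).mul (h.add_odd odd_one)
    exact Int.not_even_iff_odd.2 h1 (even_iff_two_dvd.2 ((dvd_pow_self 2 k.succ_ne_zero).trans hz))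
  obtain ⟨w, rfl⟩ := hodd
  have hw : (2 : ℤ) ^ k ∣ 2 * (w * (w + 1)) := by
    rw [← mul_dvd_mul_iff_right (two_ne_zero (α := ℤ)), ← pow_succ,
      show 2 * (w * (w + 1)) * 2 = (2 * w + 1 - 1) * (2 * w + 1 + 1) by ring]
    exact hz
  have key : (2 : ℤ) ^ k ∣ 2 * w ∨ (2 : ℤ) ^ k ∣ 2 * (w + 1) := by
    rcases w.even_or_odd with h | h
    · left
      have : IsCoprime ((2 : ℤ) ^ k) (w + 1) :=
        (Int.isCoprime_two_left.2 (h.add_odd odd_one)).pow_left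
      exact this.dvd_of_dvd_mul_right (by rwa [mul_assoc])
    · right
      have : IsCoprime ((2 : ℤ) ^ k) w :=
        (Int.isCoprime_two_left.2 h).pow_left
      exact this.dvd_of_dvd_mul_right (by rwa [mul_assoc, mul_comm (w + 1)])
  simp only [mem_insert, mem_singleton]
  rcases key with h | h <;> rcases cast_eq _ h with h | h <;> push_cast at h ⊢
  · left
    linear_combination h
  · right; left
    linear_combination h
  · right; right; left
    linear_combination h
  · right; right; right
    linear_combination h

theorem card_sq_eq_one_le {p k : ℕ} [NeZero (p ^ k)] (hp : p.Prime) (hk : 0 < k) :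
    #{u : ZMod (p ^ k) | u ^ 2 = 1} ≤ 2 * Nat.gcd 2 (p ^ k) := by
  obtain rfl | hp2 := eq_or_ne p 2
  · rw [Nat.gcd_eq_left (dvd_pow_self 2 hk.ne')]
    obtain ⟨k, rfl⟩ := Nat.exists_eq_succ_of_ne_zero hk.ne'
    exact card_sq_eq_one_two_pow_le_four k
  · exact (card_sq_eq_one_le_two hp hp2 hk).trans
      (Nat.le_mul_of_pos_right _ (Nat.gcd_pos_of_pos_left _ two_pos))

/-- The number of solutions modulo `m * n` is at most the product of the numbers of solutions
modulo `m` and modulo `n`. -/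
theorem card_solutions_mul_le {m n : ℕ} [NeZero m] [NeZero n] (h : m.Coprime n) (D a : ℤ) :
    Nat.card {t : ZMod (m * n) × ZMod (m * n) × ZMod (m * n) //
        (t.1 * t.2.1 + 1) ^ 2 + (D : ZMod (m * n)) * (t.2.1 * t.2.2) ^ 2 = (a : ZMod (m * n))} ≤
      Nat.card {t : ZMod m × ZMod m × ZMod m //
        (t.1 * t.2.1 + 1) ^ 2 + (D : ZMod m) * (t.2.1 * t.2.2) ^ 2 = (a : ZMod m)} *
      Nat.card {t : ZMod n × ZMod n × ZMod n //
        (t.1 * t.2.1 + 1) ^ 2 + (D : ZMod n) * (t.2.1 * t.2.2) ^ 2 = (a : ZMod n)} := by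
  let e := chineseRemainder h
  let φ : ZMod (m * n) →+* ZMod m := (RingHom.fst _ _).comp e.toRingHom
  let ψ : ZMod (m * n) →+* ZMod n := (RingHom.snd _ _).comp e.toRingHom
  have hinj {x y : ZMod (m * n)} (h₁ : φ x = φ y) (h₂ : ψ x = ψ y) : x = y :=
    e.injective (Prod.ext h₁ h₂)
  rw [← Nat.card_prod]
  refine Nat.card_le_card_of_injective (fun t ↦
    (⟨(φ t.1.1, φ t.1.2.1, φ t.1.2.2), by simpa using congrArg φ t.2⟩,
      ⟨(ψ t.1.1, ψ t.1.2.1, ψ t.1.2.2), by simpa using congrArg ψ t.2⟩)) ?_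
  rintro ⟨⟨x, b, c⟩, hx⟩ ⟨⟨x', b', c'⟩, hx'⟩ heq
  simp only [Prod.mk.injEq, Subtype.mk.injEq] at heq ⊢
  obtain ⟨⟨h₁, h₂, h₃⟩, h₄, h₅, h₆⟩ := heq
  exact ⟨hinj h₁ h₄, hinj h₂ h₅, hinj h₃ h₆⟩

theorem card_solutions_le_gcd (D a : ℤ) (f : ℕ) (hf : 0 < f) (ha : IsCoprime a (f : ℤ)) :
    Nat.card {t : ZMod f × ZMod f × ZMod f //
        (t.1 * t.2.1 + 1) ^ 2 + (D : ZMod f) * (t.2.1 * t.2.2) ^ 2 = (a : ZMod f)} ≤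
      Nat.gcd 2 f * 4 ^ f.primeFactors.card * f.divisors.card * f ^ 2 := by
  induction f using Nat.recOnPosPrimePosCoprime with
  | zero => exact absurd hf (lt_irrefl 0)
  | one =>
    refine (Finite.card_le_one_iff_subsingleton.2 ⟨fun x y ↦ ?_⟩).trans_eq (by simp)
    exact Subtype.ext (Subsingleton.elim (α := ZMod 1 × ZMod 1 × ZMod 1) _ _)
  | prime_pow p k hp hk =>
    have : NeZero (p ^ k) := ⟨hf.ne'⟩
    have := isLocalRing_prime_pow hp hk
    have hau : IsUnit (a : ZMod (p ^ k)) := (coe_int_isUnit_iff_isCoprime _ _).2 ha.symm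
    rw [Nat.card_eq_fintype_card, Fintype.card_subtype, Nat.primeFactors_prime_pow hk.ne' hp,
      card_singleton]
    refine (card_solutions_le _ _ hau).trans ?_
    rw [ZMod.card]
    calc _ ≤ 2 * (2 * Nat.gcd 2 (p ^ k)) * p ^ k * ((p ^ k).divisors.card * p ^ k) := by
          gcongr
          · exact card_sq_eq_one_le hp hk
          · exact card_mul_eq_zero_le _
      _ = _ := by ring
  | coprime m n hm hn hmn ihm ihn =>
    have : NeZero m := ⟨by lia⟩
    have : NeZero n := ⟨by lia⟩
    rw [Nat.cast_mul] at ha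
    refine (card_solutions_mul_le hmn D a).trans ((Nat.mul_le_mul
      (ihm (by lia) ha.of_mul_right_left) (ihn (by lia) ha.of_mul_right_right)).trans_eq ?_)
    rw [hmn.primeFactors_mul, card_union_of_disjoint hmn.disjoint_primeFactors,
      hmn.card_divisors_mul, hmn.gcd_mul]
    ring

end ZMod

/-- For a positive squarefree integer `D ≡ 1, 2 (mod 4)`, a positive integer `f` and an integer
`a` coprime to `f`, the number of triples `(α, β, γ)` in `(ℤ/fℤ)³` with
`(αβ + 1)² + D(βγ)² ≡ a (mod f)` is at most `2·4^{ω(f)}·τ(f)·f²`. -/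
theorem statement15 (D : ℤ) (hD : 0 < D) (hsf : Squarefree D)
    (hDmod : D % 4 = 1 ∨ D % 4 = 2) (f : ℕ) (hf : 0 < f) (a : ℤ) (ha : IsCoprime a (f : ℤ)) :
    Nat.card {t : ZMod f × ZMod f × ZMod f //
        (t.1 * t.2.1 + 1) ^ 2 + (D : ZMod f) * (t.2.1 * t.2.2) ^ 2 = (a : ZMod f)} ≤
      2 * 4 ^ f.primeFactors.card * f.divisors.card * f ^ 2 := by
  refine (ZMod.card_solutions_le_gcd D a f hf ha).trans ?_
  gcongr
  exact Nat.gcd_le_left f two_pos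
end
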